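/- For any ℂ-convex domain D ⊆ ℂ^n, any z ∈ D and any X ∈ ℂ^n one has κ_D(z;X) ≤ 4·γ_D(z;X). -/

import Mathlib

open Complex Metric Set MeasureTheory

noncomputable section

/-- `ℂ^n` with the Euclidean (Hermitian) structure. -/
abbrev Cn (n : ℕ) := EuclideanSpace ℂ (Fin n)

instance (n : ℕ) : MeasurableSpace (Cn n) := borel _
instance (n : ℕ) : BorelSpace (Cn n) := ⟨rfl⟩

/-- The complex affine line through `z` in direction `X`. -/
def cline {n : ℕ} (z X : Cn n) : Set (Cn n) := {w | ∃ l : ℂ, w = z + l • X}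

/-- A domain: a nonempty connected open set. -/
def IsDomain' {n : ℕ} (D : Set (Cn n)) : Prop := IsOpen D ∧ IsConnected D

/-- `D` is ℂ-convex: its intersection with every complex affine line is, when
nonempty, connected and simply connected. -/
def IsCConvex {n : ℕ} (D : Set (Cn n)) : Prop :=
  ∀ z X : Cn n, X ≠ 0 → (D ∩ cline z X).Nonempty →
    IsConnected (D ∩ cline z X) ∧ SimplyConnectedSpace ↥(D ∩ cline z X)

/-- The Carathéodory metric `γ_D(z;X)`. -/
def caraMetric {n : ℕ} (D : Set (Cn n)) (z X : Cn n) : ℝ :=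
  sSup {r : ℝ | ∃ f : Cn n → ℂ, DifferentiableOn ℂ f D ∧ MapsTo f D (ball (0:ℂ) 1) ∧
    f z = 0 ∧ r = ‖fderiv ℂ f z X‖}

/-- The Kobayashi metric `κ_D(z;X)`. -/
def kobMetric {n : ℕ} (D : Set (Cn n)) (z X : Cn n) : ℝ :=
  sInf {a : ℝ | 0 ≤ a ∧ ∃ φ : ℂ → Cn n, DifferentiableOn ℂ φ (ball (0:ℂ) 1) ∧
    MapsTo φ (ball (0:ℂ) 1) D ∧ φ 0 = z ∧ a • (fderiv ℂ φ 0 1) = X}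

/-- The distance `d_D(z,X)` from `z` to `∂D` in direction `X`. -/
def dirDist {n : ℕ} (D : Set (Cn n)) (z X : Cn n) : ℝ :=
  sSup {r : ℝ | 0 < r ∧ ∀ l : ℂ, ‖l‖ < r → z + l • X ∈ D}

/-- The Euclidean distance `d_D(z)` from `z` to `∂D`. -/
def bdist {n : ℕ} (D : Set (Cn n)) (z : Cn n) : ℝ := Metric.infDist z (frontier D)

/-- `L_a`: the set of vectors `X` such that a disc `{a + λX : |λ| < ε}` lies in `∂D`. -/
def La {n : ℕ} (D : Set (Cn n)) (a : Cn n) : Set (Cn n) :=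
  {X | ∃ ε > (0:ℝ), ∀ l : ℂ, ‖l‖ < ε → a + l • X ∈ frontier D}

/-- `D` contains no complex affine line. -/
def NoComplexLine {n : ℕ} (D : Set (Cn n)) : Prop :=
  ¬ ∃ z X : Cn n, X ≠ 0 ∧ cline z X ⊆ D

/-- The Bergman kernel `K_D(z)` (restricted to the diagonal). -/
def bergmanKernel {n : ℕ} (D : Set (Cn n)) (z : Cn n) : ℝ :=
  sSup {r : ℝ | ∃ f : Cn n → ℂ, DifferentiableOn ℂ f D ∧
    IntegrableOn (fun w => ‖f w‖ ^ 2) D ∧ (∫ w in D, ‖f w‖ ^ 2) ≤ 1 ∧ r = ‖f z‖ ^ 2}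

/-- `M_D(z;X)`. -/
def bergmanM {n : ℕ} (D : Set (Cn n)) (z X : Cn n) : ℝ :=
  sSup {r : ℝ | ∃ f : Cn n → ℂ, DifferentiableOn ℂ f D ∧
    IntegrableOn (fun w => ‖f w‖ ^ 2) D ∧ (∫ w in D, ‖f w‖ ^ 2) = 1 ∧
    f z = 0 ∧ r = ‖fderiv ℂ f z X‖}

/-- The Bergman metric `B_D(z;X) = M_D(z;X)/√K_D(z)`. -/
def bergmanMetric {n : ℕ} (D : Set (Cn n)) (z X : Cn n) : ℝ :=
  bergmanM D z X / Real.sqrt (bergmanKernel D z)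

/-- `G` is weakly linearly convex: through every boundary point there is a complex
affine hyperplane missing `G`. -/
def WeaklyLinConvex {n : ℕ} (G : Set (Cn n)) : Prop :=
  ∀ a ∈ frontier G, ∃ ℓ : Cn n →L[ℂ] ℂ, ℓ ≠ 0 ∧ ∀ z ∈ G, ℓ z ≠ ℓ a

/-- `d_{j,D}(z)` from the minimal-distance construction: the distance from `z` to the
boundary of the slice of `D` by the affine subspace `z + span{v_i : i ≥ j}`. -/
def sliceDist {n : ℕ} (D : Set (Cn n)) (z : Cn n) (v : Fin n → Cn n) (j : Fin n) : ℝ :=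
  sSup {r : ℝ | 0 < r ∧
    ∀ w ∈ Submodule.span ℂ (v '' {i | j ≤ i}), ‖w‖ < r → z + w ∈ D}

/-- The data `(v j)` is an admissible output of the minimal-distance construction at `z`:
the directions are orthonormal and each `v j` realizes the distance `d_{j,D}(z)` to the
boundary of the corresponding slice. -/
def MinimalBasis {n : ℕ} (D : Set (Cn n)) (z : Cn n) (v : Fin n → Cn n) : Prop :=
  Orthonormal ℂ v ∧ ∀ j : Fin n, z + (sliceDist D z v j) • v j ∉ D

open scoped Topology

/-- Two continuous logarithms of the same function on a preconnected set differ by a constant. -/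
theorem IsPreconnected.sub_eq_sub_of_exp_eq {X : Type*} [TopologicalSpace X] {S : Set X}
    (hS : IsPreconnected S) {f g : X → ℂ} (hf : ContinuousOn f S) (hg : ContinuousOn g S)
    (h : ∀ x ∈ S, exp (f x) = exp (g x)) {x y : X} (hx : x ∈ S) (hy : y ∈ S) :
    f x - g x = f y - g y := by
  have hc : ((range fun n : ℤ => (n : ℂ) * (2 * Real.pi * I))).Countable := countable_range _
  refine hc.isTotallyDisconnected ((fun x => f x - g x) '' S) ?_
    (hS.image _ (hf.sub hg)) (mem_image_of_mem _ hx) (mem_image_of_mem _ hy)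
  rintro _ ⟨z, hz, rfl⟩
  obtain ⟨n, hn⟩ := exp_eq_exp_iff_exists_int.1 (h z hz)
  exact ⟨n, by simp [hn]⟩

/-- If the slices of an open set `D` by the complex lines through `q` are simply connected and
a nonvanishing function `g` has a continuous logarithm along a continuous choice of one point on
each slice, then `g` has a continuous logarithm on `D`. -/
theorem exists_continuousOn_log_of_slices {V : Type*} [NormedAddCommGroup V] [NormedSpace ℂ V]
    {D : Set V} (hD : IsOpen D) (q : V)
    (hsc : ∀ w ∈ D, IsSimplyConnected {l : ℂ | q + l • (w - q) ∈ D})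
    {c : V → ℂ} (hc : ContinuousOn c D) (hcD : ∀ w ∈ D, q + c w • (w - q) ∈ D)
    {g : V → ℂ} (hg : ContinuousOn g D) (hg0 : ∀ w ∈ D, g w ≠ 0)
    {h : V → ℂ} (hh : ContinuousOn h D) (hhg : ∀ w ∈ D, exp (h w) = g (q + c w • (w - q))) :
    ∃ L : V → ℂ, ContinuousOn L D ∧ ∀ w ∈ D, exp (L w) = g w := by
  let _ : NormedSpace ℝ V := NormedSpace.restrictScalars ℝ ℂ V
  have hK : ∀ w : V, ∃ K : ℂ → ℂ, w ∈ D →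
      ContinuousOn K {l : ℂ | q + l • (w - q) ∈ D} ∧
      (∀ l : ℂ, q + l • (w - q) ∈ D → exp (K l) = g (q + l • (w - q))) ∧ K (c w) = h w := by
    intro w
    by_cases hw : w ∈ D
    swap
    · exact ⟨0, fun h => absurd h hw⟩
    have hcont : Continuous fun l : ℂ => q + l • (w - q) := by fun_prop
    obtain ⟨K, hK, hKe⟩ := exists_continuousOn_eqOn_exp_comp (hsc w hw) (hD.preimage hcont)
      (g := fun l => g (q + l • (w - q))) (hg.comp hcont.continuousOn fun _ hl => hl)
      (by rintro ⟨l, hl, h0⟩; exact hg0 _ hl h0)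
    refine ⟨fun l => K l + (h w - K (c w)), fun _ => ⟨hK.add continuousOn_const, ?_, by ring⟩⟩
    intro l hl
    have h1 : exp (K l) = _ := hKe hl
    have h2 : exp (K (c w)) = _ := hKe (hcD w hw)
    rw [exp_add, exp_sub, h1, h2, hhg w hw, div_self (hg0 _ (hcD w hw)), mul_one]
  choose K hK using hK
  have hone : ∀ w : V, q + (1 : ℂ) • (w - q) = w := fun w => by simp
  refine ⟨fun w => K w 1, ?_, fun w hw => ?_⟩
  swap
  · have := (hK w hw).2.1 1 (by rwa [hone])
    rwa [hone] at this
  intro w₀ hw₀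
  refine ContinuousAt.continuousWithinAt ?_
  obtain ⟨γ, hγ⟩ := (hsc w₀ hw₀).isPathConnected.joinedIn (c w₀) (hcD w₀ hw₀) 1
    (by simpa using hw₀)
  set Q : unitInterval × V → V := fun p =>
    q + (γ p.1 + (1 - (p.1 : ℝ) : ℂ) * (c p.2 - c w₀)) • (p.2 - q) with hQ
  have hQc : ContinuousOn Q (univ ×ˢ D) := by
    have : ContinuousOn (fun p : unitInterval × V => c p.2) (univ ×ˢ D) :=
      hc.comp continuousOn_snd fun p hp => hp.2
    have hγc : Continuous fun p : unitInterval × V => γ p.1 := γ.continuous.comp continuous_fst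
    have h3 : Continuous fun p : unitInterval × V => (1 - ((p.1 : ℝ) : ℂ)) := by fun_prop
    exact continuousOn_const.add ((hγc.continuousOn.add (h3.continuousOn.mul
      (this.sub continuousOn_const))).smul (continuousOn_snd.sub continuousOn_const))
  have hev : ∀ᶠ w in 𝓝 w₀, ∀ t ∈ (univ : Set unitInterval), Q (t, w) ∈ D := by
    refine isCompact_univ.eventually_forall_of_forall_eventually fun t _ => ?_
    have hcat : ContinuousAt Q (t, w₀) :=
      hQc.continuousAt ((isOpen_univ.prod hD).mem_nhds ⟨mem_univ _, hw₀⟩)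
    have hcat' : ContinuousAt (fun z : V × unitInterval => Q (z.2, z.1)) (w₀, t) :=
      ContinuousAt.comp (f := fun z : V × unitInterval => (z.2, z.1)) (g := Q) (x := (w₀, t))
        hcat (by fun_prop)
    refine hcat'.eventually_mem (hD.mem_nhds ?_)
    simp only [hQ, sub_self, mul_zero, add_zero]
    exact hγ t
  obtain ⟨ε, hε, hball⟩ := Metric.eventually_nhds_iff_ball.1 (hev.and (hD.mem_nhds hw₀))
  set N := ball w₀ ε
  have hNs : IsSimplyConnected ((univ : Set ℝ) ×ˢ N) := by
    have hcv : Convex ℝ ((univ : Set ℝ) ×ˢ N) := convex_univ.prod (convex_ball _ _)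
    have : ContractibleSpace ((univ : Set ℝ) ×ˢ N : Set (ℝ × V)) :=
      hcv.contractibleSpace ⟨(0, w₀), mem_univ _, mem_ball_self hε⟩
    exact SimplyConnectedSpace.ofContractible _
  set R : ℝ × V → V := fun p => Q (projIcc 0 1 zero_le_one p.1, p.2) with hR
  have hRD : ∀ p ∈ (univ : Set ℝ) ×ˢ N, R p ∈ D := fun p hp => (hball _ hp.2).1 _ (mem_univ _)
  have hRc : ContinuousOn R (univ ×ˢ N) := by
    refine hQc.comp (f := fun p : ℝ × V => (projIcc (0 : ℝ) 1 zero_le_one p.1, p.2)) ?_ ?_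
    · exact (Continuous.prodMk (continuous_projIcc.comp continuous_fst)
        continuous_snd).continuousOn
    · exact fun p hp => ⟨mem_univ _, (hball _ hp.2).2⟩
  obtain ⟨M, hM, hMe⟩ := exists_continuousOn_eqOn_exp_comp hNs
    (isOpen_univ.prod isOpen_ball) (g := g ∘ R) (hg.comp hRc hRD)
    (by rintro ⟨p, hp, h0⟩; exact hg0 _ (hRD p hp) h0)
  have key : ∀ w ∈ N, K w 1 = M (1, w) - M (0, w) + h w := by
    intro w hw
    obtain ⟨hK1, hK2, hK3⟩ := hK w (hball w hw).2
    set a : ℝ → ℂ := fun t => γ (projIcc 0 1 zero_le_one t) +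
      (1 - ((projIcc (0 : ℝ) 1 zero_le_one t : ℝ) : ℂ)) * (c w - c w₀) with ha
    have hpc : Continuous fun t : ℝ => projIcc (0 : ℝ) 1 zero_le_one t := continuous_projIcc
    have hac : Continuous a :=
      (γ.continuous.comp hpc).add (((continuous_const.sub
        (continuous_ofReal.comp (continuous_subtype_val.comp hpc)))).mul continuous_const)
    have haD : ∀ t, q + a t • (w - q) ∈ D := fun t => hRD (t, w) ⟨mem_univ _, hw⟩
    have := isPreconnected_univ.sub_eq_sub_of_exp_eq (f := fun t : ℝ => M (t, w))
      (g := fun t => K w (a t)) (hM.comp (by fun_prop) fun t _ => ⟨mem_univ _, hw⟩)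
      (hK1.comp hac.continuousOn fun t _ => haD t)
      (fun t _ => by
        have h1 : exp (M (t, w)) = _ := hMe (⟨mem_univ _, hw⟩ : (t, w) ∈ univ ×ˢ N)
        rw [h1, hK2 _ (haD t)]; rfl) (mem_univ (1 : ℝ)) (mem_univ (0 : ℝ))
    have h1 : a 1 = 1 := by simp [ha]
    have h0 : a 0 = c w := by simp [ha]
    simp only [h1, h0, hK3] at this
    linear_combination -this
  have hN : N ∈ 𝓝 w₀ := ball_mem_nhds _ hε
  have hcont : ContinuousOn (fun w => M (1, w) - M (0, w) + h w) N :=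
    ((hM.comp (f := fun w => ((1 : ℝ), w)) (by fun_prop) fun w hw => ⟨mem_univ _, hw⟩).sub
      (hM.comp (f := fun w => ((0 : ℝ), w)) (by fun_prop) fun w hw => ⟨mem_univ _, hw⟩)).add
      (hh.mono fun w hw => (hball w hw).2)
  refine (hcont.continuousAt hN).congr ?_
  filter_upwards [hN] with w hw using (key w hw).symm
theorem IsCConvex.isSimplyConnected_slice {n : ℕ} {D : Set (Cn n)} (hcc : IsCConvex D)
    (q v : Cn n) (hne : ∃ l : ℂ, q + l • v ∈ D) :
    IsSimplyConnected {l : ℂ | q + l • v ∈ D} := by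
  rcases eq_or_ne v 0 with rfl | hv
  · have : {l : ℂ | q + l • (0 : Cn n) ∈ D} = univ := by
      obtain ⟨l, hl⟩ := hne
      ext m
      simpa using hl
    rw [this]
    have : ContractibleSpace (univ : Set ℂ) := convex_univ.contractibleSpace ⟨0, mem_univ _⟩
    exact SimplyConnectedSpace.ofContractible _
  · have hemb : Topology.IsEmbedding fun l : ℂ => q + l • v :=
      (Homeomorph.addLeft q).isEmbedding.comp (isClosedEmbedding_smul_left hv).isEmbedding
    rw [← hemb.isSimplyConnected_image]
    have himg : (fun l : ℂ => q + l • v) '' {l : ℂ | q + l • v ∈ D} = D ∩ cline q v := by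
      ext w
      constructor
      · rintro ⟨l, hl, rfl⟩
        exact ⟨hl, l, rfl⟩
      · rintro ⟨hw, l, rfl⟩
        exact ⟨l, hw, rfl⟩
    rw [himg]
    obtain ⟨l, hl⟩ := hne
    exact (hcc q v hv ⟨_, hl, l, rfl⟩).2

theorem not_exists_continuousOn_log_circle (f : ℝ → ℂ) (hf : Continuous f)
    (hper : f (2 * Real.pi) = f 0) (c : ℂ)
    (hexp : ∀ t : ℝ, exp (f t) = exp (c + t * I)) : False := by
  have := isPreconnected_univ.sub_eq_sub_of_exp_eq (f := f) (g := fun t : ℝ => c + t * I)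
    hf.continuousOn (by fun_prop) (fun t _ => hexp t) (mem_univ 0) (mem_univ (2 * Real.pi))
  simp only [hper] at this
  have h2 : (2 * Real.pi : ℂ) * I = 0 := by
    push_cast at this
    linear_combination this
  simp [Real.pi_ne_zero] at h2

/-- The complex tangent hyperplane to a ball contained in a ℂ-convex open set `D`, at a point of
the sphere outside `D`, does not meet `D`. -/
theorem IsCConvex.inner_ne_zero_of_ball_subset {n : ℕ} {D : Set (Cn n)} (hD : IsOpen D)
    (hcc : IsCConvex D) {p b : Cn n} (hpb : p ≠ b) (hball : ball p ‖p - b‖ ⊆ D) (hb : b ∉ D)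
    {w : Cn n} (hw : w ∈ D) : inner ℂ (p - b) (w - b) ≠ 0 := by
  intro hw0
  set x : Cn n → ℂ := fun u => inner ℂ (p - b) (u - b) with hx
  have hxc : Continuous x := by fun_prop
  have hxl : ∀ (l : ℂ) u, x (b + l • (u - b)) = l * x u := by
    intro l u
    simp only [hx, add_sub_cancel_left, inner_smul_right]
  set E : Set (Cn n) := D ∩ {u | x u ≠ 0} with hE
  have hEo : IsOpen E := hD.inter (isOpen_ne_fun hxc continuous_const)
  have hub : ∀ u ∈ E, u - b ≠ 0 := by
    rintro u ⟨-, hu⟩ h0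
    exact hu (by simp only [hx, h0, inner_zero_right])
  set c : Cn n → ℂ := fun u => (starRingEnd ℂ) (x u) / (‖u - b‖ ^ 2 : ℝ) with hc
  have hcx : ∀ u, c u * x u = ((‖x u‖ ^ 2 / ‖u - b‖ ^ 2 : ℝ) : ℂ) := by
    intro u
    simp only [hc]
    rw [div_mul_eq_mul_div, mul_comm, Complex.mul_conj, Complex.normSq_eq_norm_sq]
    push_cast
    rfl
  have hcE : ∀ u ∈ E, b + c u • (u - b) ∈ E := by
    intro u hu
    have hu0 : 0 < ‖u - b‖ := norm_pos_iff.2 (hub u hu)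
    have hxu : 0 < ‖x u‖ := norm_pos_iff.2 hu.2
    refine ⟨hball ?_, ?_⟩
    · rw [mem_ball_iff_norm, ← sq_lt_sq₀ (norm_nonneg _) (norm_nonneg _)]
      have h1 : b + c u • (u - b) - p = c u • (u - b) - (p - b) := by abel
      have h2 : inner ℂ (p - b) (c u • (u - b)) = ((‖x u‖ ^ 2 / ‖u - b‖ ^ 2 : ℝ) : ℂ) := by
        rw [inner_smul_right, ← hcx]
      have h3 : ‖c u • (u - b)‖ ^ 2 = ‖x u‖ ^ 2 / ‖u - b‖ ^ 2 := by
        rw [norm_smul, hc]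
        simp only [norm_div, RCLike.norm_conj, Complex.norm_real, norm_pow, norm_norm]
        field_simp
      rw [h1, @norm_sub_sq ℂ, ← inner_re_symm, h2, h3]
      have : 0 < ‖x u‖ ^ 2 / ‖u - b‖ ^ 2 := by positivity
      simp only [RCLike.re_to_complex, Complex.ofReal_re]
      linarith
    · change x _ ≠ 0
      rw [hxl, hcx]
      exact_mod_cast (by positivity : ‖x u‖ ^ 2 / ‖u - b‖ ^ 2 ≠ 0)
  have hcc' : ContinuousOn c E := by
    refine ContinuousOn.div (by fun_prop) (by fun_prop) fun u hu => ?_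
    exact_mod_cast pow_ne_zero 2 (norm_ne_zero_iff.2 (hub u hu))
  obtain ⟨L, hL, hLe⟩ := exists_continuousOn_log_of_slices hEo b (fun u hu => by
      have : {l : ℂ | b + l • (u - b) ∈ E} = {l : ℂ | b + l • (u - b) ∈ D} := by
        ext l
        refine ⟨fun h => h.1, fun h => ⟨h, ?_⟩⟩
        change x _ ≠ 0
        rw [hxl]
        refine mul_ne_zero ?_ hu.2
        rintro rfl
        exact hb (by simpa using h)
      rw [this]
      exact hcc.isSimplyConnected_slice b _ ⟨1, by simpa using hu.1⟩) hcc' hcE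
    (g := x) hxc.continuousOn (fun u hu => hu.2)
    (h := fun u => ((Real.log (‖x u‖ ^ 2 / ‖u - b‖ ^ 2) : ℝ) : ℂ))
    (by
      refine Complex.continuous_ofReal.comp_continuousOn (ContinuousOn.log ?_ ?_)
      · refine ContinuousOn.div (by fun_prop) (by fun_prop) fun u hu => ?_
        exact pow_ne_zero 2 (norm_ne_zero_iff.2 (hub u hu))
      · intro u hu
        have hu0 : 0 < ‖u - b‖ := norm_pos_iff.2 (hub u hu)
        have hxu : 0 < ‖x u‖ := norm_pos_iff.2 hu.2
        positivity)
    (fun u hu => by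
      have hu0 : 0 < ‖u - b‖ := norm_pos_iff.2 (hub u hu)
      have hxu : 0 < ‖x u‖ := norm_pos_iff.2 hu.2
      rw [hxl, hcx, ← Complex.ofReal_exp, Real.exp_log (by positivity)])
  obtain ⟨ε, hε, hwε⟩ := Metric.isOpen_iff.1 hD w hw
  have hpb' : 0 < ‖p - b‖ := norm_pos_iff.2 (sub_ne_zero.2 hpb)
  set δ : ℝ := ε / 2 / ‖p - b‖ with hδ
  have hδ0 : 0 < δ := by positivity
  set loop : ℝ → Cn n := fun t => w + ((δ : ℂ) * exp (t * I)) • (p - b) with hloop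
  have hxloop : ∀ t, x (loop t) = exp ((Real.log (δ * ‖p - b‖ ^ 2) : ℝ) + t * I) := by
    intro t
    rw [exp_add, ← Complex.ofReal_exp, Real.exp_log (by positivity)]
    have : loop t - b = (w - b) + ((δ : ℂ) * exp (t * I)) • (p - b) := by
      simp only [hloop]; abel
    simp only [hx, this, inner_add_right, hw0, inner_smul_right, inner_self_eq_norm_sq_to_K]
    push_cast
    simp only [Complex.coe_algebraMap]
    ring
  have hloopE : ∀ t, loop t ∈ E := by
    intro t
    refine ⟨hwε ?_, ?_⟩
    · rw [mem_ball_iff_norm]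
      simp only [hloop, add_sub_cancel_left, norm_smul, norm_mul, Complex.norm_exp_ofReal_mul_I,
        Complex.norm_real, Real.norm_of_nonneg hδ0.le, mul_one]
      rw [hδ, div_mul_cancel₀ _ hpb'.ne']
      linarith
    · change x _ ≠ 0
      rw [hxloop]
      exact exp_ne_zero _
  refine not_exists_continuousOn_log_circle (fun t => L (loop t))
    (hL.comp_continuous (by fun_prop) hloopE) ?_ _ fun t => (hLe _ (hloopE t)).trans (hxloop t)
  simp [hloop]

theorem IsCConvex.exists_inner_ne_zero {n : ℕ} {D : Set (Cn n)} (hD : IsOpen D)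
    (hcc : IsCConvex D) {a : Cn n} (ha : a ∉ D) (ha' : a ∈ closure D) :
    ∃ v : Cn n, ∀ w ∈ D, inner ℂ v (w - a) ≠ 0 := by
  obtain ⟨p, hpD, hpa⟩ := mem_closure_iff_seq_limit.1 ha'
  have hcl : IsClosed Dᶜ := hD.isClosed_compl
  have hne : (Dᶜ).Nonempty := ⟨a, ha⟩
  choose b hb hbd using fun k => hcl.exists_infDist_eq_dist hne (p k)
  have hpb : ∀ k, p k - b k ≠ 0 := fun k h => hb k (sub_eq_zero.1 h ▸ hpD k)
  have hba : Filter.Tendsto b Filter.atTop (𝓝 a) := by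
    have h1 : Filter.Tendsto (fun k => dist (p k) a) Filter.atTop (𝓝 0) :=
      tendsto_iff_dist_tendsto_zero.1 hpa
    refine tendsto_iff_dist_tendsto_zero.2 (squeeze_zero (fun _ => dist_nonneg) (fun k => ?_)
      (by simpa using h1.const_mul 2))
    have h2 : dist (p k) (b k) ≤ dist (p k) a := hbd k ▸ infDist_le_dist_of_mem ha
    have h3 := dist_triangle_left (b k) a (p k)
    linarith
  set u : ℕ → Cn n := fun k => ((‖p k - b k‖⁻¹ : ℝ) : ℂ) • (p k - b k) with hu
  have hu1 : ∀ k, ‖u k‖ = 1 := fun k => by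
    simp [hu, norm_smul, norm_ne_zero_iff.2 (hpb k)]
  have huD : ∀ k, ∀ w ∈ D, inner ℂ (u k) (w - b k) ≠ 0 := by
    intro k w hw
    have hball : ball (p k) ‖p k - b k‖ ⊆ D := by
      rw [← dist_eq_norm, ← hbd k]
      exact ball_infDist_compl_subset
    have := hcc.inner_ne_zero_of_ball_subset hD (sub_ne_zero.1 (hpb k)) hball (hb k) hw
    simp only [hu, inner_smul_left]
    refine mul_ne_zero ?_ this
    simpa using hpb k
  obtain ⟨v, hv, φ, hφ, hlim⟩ := (isCompact_sphere (0 : Cn n) 1).tendsto_subseq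
    (x := u) fun k => by simpa using hu1 k
  refine ⟨v, fun w hw h0 => ?_⟩
  have hlim2 : Filter.Tendsto
      (fun k => w - inner ℂ (u (φ k)) (w - b (φ k)) • u (φ k)) Filter.atTop (𝓝 w) := by
    have hb' := hba.comp hφ.tendsto_atTop
    have := (tendsto_const_nhds (x := w)).sub
      ((hlim.inner (𝕜 := ℂ) ((tendsto_const_nhds (x := w)).sub hb')).smul hlim)
    rw [h0, zero_smul, sub_zero] at this
    exact this
  obtain ⟨k, hk⟩ := (hlim2.eventually_mem (hD.mem_nhds hw)).exists
  refine huD (φ k) _ hk ?_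
  have : w - inner ℂ (u (φ k)) (w - b (φ k)) • u (φ k) - b (φ k) =
      (w - b (φ k)) - inner ℂ (u (φ k)) (w - b (φ k)) • u (φ k) := by abel
  rw [this, inner_sub_right, inner_smul_right, inner_self_eq_norm_sq_to_K, hu1]
  simp only [RCLike.ofReal_one, one_pow, mul_one, sub_self]

/-- The integral of a holomorphic function vanishing at the origin against a radial weight on an
annulus around the origin is zero. -/
theorem setIntegral_annulus_inv_norm_sq_smul_eq_zero {R r : ℝ} (hR : 1 < R)
    {p : ℂ → ℂ} (hp : DifferentiableOn ℂ p (ball 0 R)) (hp0 : p 0 = 0) :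
    ∫ z in closedBall (0 : ℂ) 1 \ ball 0 r, (‖z‖ ^ 2)⁻¹ • p z = 0 := by
  have hA : MeasurableSet (closedBall (0 : ℂ) 1 \ ball 0 r) :=
    measurableSet_closedBall.diff measurableSet_ball
  rw [← integral_indicator hA, ← Complex.integral_comp_polarCoord_symm]
  set G : ℝ × ℝ → ℂ := fun x => x.1 • (closedBall (0 : ℂ) 1 \ ball 0 r).indicator
    (fun z => (‖z‖ ^ 2)⁻¹ • p z) (Complex.polarCoord.symm x) with hG
  by_cases hGint : IntegrableOn G (_root_.polarCoord.target)
  swap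
  · exact integral_undef hGint
  rw [polarCoord_target] at hGint ⊢
  rw [Measure.volume_eq_prod] at hGint ⊢
  rw [setIntegral_prod _ hGint]
  refine setIntegral_eq_zero_of_forall_eq_zero fun x hx => ?_
  have hx : 0 < x := hx
  have hn : ∀ y : ℝ, ‖Complex.polarCoord.symm (x, y)‖ = x := fun y => by
    rw [Complex.norm_polarCoord_symm, abs_of_pos hx]
  by_cases hx1 : x ≤ 1 ∧ r ≤ x
  swap
  · refine setIntegral_eq_zero_of_forall_eq_zero fun y _ => ?_
    have : Complex.polarCoord.symm (x, y) ∉ closedBall (0 : ℂ) 1 \ ball 0 r := by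
      intro h
      simp only [mem_sdiff, mem_closedBall_zero_iff, mem_ball_zero_iff, hn, not_lt] at h
      exact hx1 h
    simp only [hG]
    rw [indicator_of_notMem this, smul_zero]
  have hGc : ∀ y : ℝ, G (x, y) = x⁻¹ • p (circleMap 0 x y) := fun y => by
    have : Complex.polarCoord.symm (x, y) ∈ closedBall (0 : ℂ) 1 \ ball 0 r := by
      simp only [mem_sdiff, mem_closedBall_zero_iff, mem_ball_zero_iff, hn, not_lt]
      exact hx1
    have he : Complex.polarCoord.symm (x, y) = circleMap 0 x y := by
      simp [Complex.polarCoord_symm_apply, circleMap, Complex.exp_mul_I]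
    simp only [hG]
    rw [indicator_of_mem this, hn, he, smul_smul]
    congr 1
    field_simp
  simp only [hGc]
  rw [integral_smul]
  have hav : Real.circleAverage p 0 x = 0 := by
    refine (DiffContOnCl.circleAverage (hp.mono ?_).diffContOnCl).trans hp0
    rw [abs_of_pos hx]
    refine closure_ball_subset_closedBall.trans (closedBall_subset_ball (by linarith))
  rw [Real.circleAverage_def] at hav
  have h2 : ∫ θ in (0 : ℝ)..2 * Real.pi, p (circleMap 0 x θ) = 0 := by
    refine (smul_eq_zero.1 hav).resolve_left (by positivity)
  have hper : Function.Periodic (fun θ => p (circleMap 0 x θ)) (2 * Real.pi) := fun θ => by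
    simp only [periodic_circleMap 0 x θ]
  have h3 := hper.intervalIntegral_add_eq (-Real.pi) 0
  rw [zero_add, h2, intervalIntegral.integral_of_le (by linarith [Real.pi_pos]),
    integral_Ioc_eq_integral_Ioo] at h3
  rw [show -Real.pi + 2 * Real.pi = Real.pi by ring] at h3
  rw [h3, smul_zero]

/-- The logarithmic area of the image of an annulus around the origin under a univalent function
fixing the origin is at least the logarithmic area of the annulus. -/
theorem lintegral_annulus_le_lintegral_logDeriv {R r : ℝ} (hR : 1 < R) (hr : 0 < r) {k : ℂ → ℂ}
    (hk : DifferentiableOn ℂ k (ball 0 R)) (hk0 : k 0 = 0) (hk' : deriv k 0 ≠ 0)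
    (hne : ∀ z ∈ ball (0 : ℂ) R, z ≠ 0 → k z ≠ 0) :
    ∫⁻ z in closedBall (0 : ℂ) 1 \ ball 0 r, ENNReal.ofReal ((‖z‖ ^ 2)⁻¹) ≤
      ∫⁻ z in closedBall (0 : ℂ) 1 \ ball 0 r, ENNReal.ofReal (‖deriv k z / k z‖ ^ 2) := by
  have hR0 : (0 : ℂ) ∈ ball (0 : ℂ) R := by simp; linarith
  set A := closedBall (0 : ℂ) 1 \ ball 0 r with hA
  have hAm : MeasurableSet A := measurableSet_closedBall.diff measurableSet_ball
  have hAc : IsCompact A := (isCompact_closedBall 0 1).diff isOpen_ball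
  have hAR : A ⊆ ball 0 R := sdiff_subset.trans (closedBall_subset_ball hR)
  have hA0 : ∀ z ∈ A, z ≠ 0 := by
    rintro z hz rfl
    exact hz.2 (mem_ball_self hr)
  set e := dslope k 0 with he
  have hed : DifferentiableOn ℂ e (ball 0 R) :=
    (differentiableOn_dslope (isOpen_ball.mem_nhds hR0)).2 hk
  have hke : ∀ z, k z = z * e z := fun z => by
    have := sub_smul_dslope k 0 z
    simpa [hk0] using this.symm
  have hene : ∀ z ∈ ball (0 : ℂ) R, e z ≠ 0 := fun z hz => by
    by_cases h0 : z = 0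
    · rw [h0, he, dslope_same]; exact hk'
    · intro h
      exact hne z hz h0 (by rw [hke, h, mul_zero])
  set p : ℂ → ℂ := fun z => z * deriv e z / e z with hp
  have hpd : DifferentiableOn ℂ p (ball 0 R) :=
    (differentiableOn_id.mul (hed.deriv isOpen_ball)).div hed hene
  have hp0 : p 0 = 0 := by simp [hp]
  have hlog : ∀ z ∈ A, ‖deriv k z / k z‖ ^ 2 = (‖z‖ ^ 2)⁻¹ * ‖1 + p z‖ ^ 2 := fun z hz => by
    have hz0 := hA0 z hz
    have hez := hene z (hAR hz)
    have hd : HasDerivAt k (e z + z * deriv e z) z := by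
      have h1 : HasDerivAt e (deriv e z) z :=
        (hed.differentiableAt (isOpen_ball.mem_nhds (hAR hz))).hasDerivAt
      have h2 := (hasDerivAt_id z).mul h1
      have h3 : k = id * e := funext fun w => hke w
      rw [h3]
      simpa using h2
    rw [hd.deriv, hke]
    have : (e z + z * deriv e z) / (z * e z) = z⁻¹ * (1 + p z) := by
      simp only [hp]
      field_simp
    rw [this, norm_mul, mul_pow, norm_inv, inv_pow]
  have hwc : ContinuousOn (fun z : ℂ => (‖z‖ ^ 2)⁻¹) A :=
    (continuous_norm.pow 2).continuousOn.inv₀ fun z hz => by simpa using hA0 z hz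
  have hpc : ContinuousOn p A := hpd.continuousOn.mono hAR
  have hi1 : IntegrableOn (fun z : ℂ => (‖z‖ ^ 2)⁻¹) A := hwc.integrableOn_compact hAc
  have hi2 : IntegrableOn (fun z : ℂ => (‖z‖ ^ 2)⁻¹ * ‖1 + p z‖ ^ 2) A :=
    (hwc.mul ((continuousOn_const.add hpc).norm.pow 2)).integrableOn_compact hAc
  have hi3 : IntegrableOn (fun z : ℂ => (‖z‖ ^ 2)⁻¹ • p z) A :=
    (hwc.smul hpc).integrableOn_compact hAc
  have hi4 : IntegrableOn (fun z : ℂ => ((‖z‖ ^ 2)⁻¹ • p z).re) A := hi3.re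
  rw [setLIntegral_congr_fun (f := fun z => ENNReal.ofReal (‖deriv k z / k z‖ ^ 2))
    (g := fun z => ENNReal.ofReal ((‖z‖ ^ 2)⁻¹ * ‖1 + p z‖ ^ 2)) hAm
    fun z hz => by simp only [hlog z hz]]
  rw [← ofReal_integral_eq_lintegral_ofReal hi1 (ae_of_all _ fun z => by positivity),
    ← ofReal_integral_eq_lintegral_ofReal hi2 (ae_of_all _ fun z => by positivity)]
  refine ENNReal.ofReal_le_ofReal ?_
  have hre : ∫ z in A, ((‖z‖ ^ 2)⁻¹ • p z).re = 0 := by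
    have h1 := integral_re (𝕜 := ℂ) hi3
    have h2 := setIntegral_annulus_inv_norm_sq_smul_eq_zero (r := r) hR hpd hp0
    simp only [← hA] at h2
    rw [h2] at h1
    simpa using h1
  calc ∫ z in A, (‖z‖ ^ 2)⁻¹ = ∫ z in A, ((‖z‖ ^ 2)⁻¹ + 2 * ((‖z‖ ^ 2)⁻¹ • p z).re) := by
        rw [integral_add hi1 (hi4.const_mul 2), integral_const_mul, hre, mul_zero, add_zero]
    _ ≤ ∫ z in A, (‖z‖ ^ 2)⁻¹ * ‖1 + p z‖ ^ 2 := by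
        refine integral_mono (hi1.add (hi4.const_mul 2)) hi2 fun z => ?_
        have h1 : ‖1 + p z‖ ^ 2 = 1 + 2 * (p z).re + ‖p z‖ ^ 2 := by
          rw [← Complex.normSq_eq_norm_sq, ← Complex.normSq_eq_norm_sq, Complex.normSq_apply,
            Complex.normSq_apply]
          simp
          ring
        have h2 : ((‖z‖ ^ 2)⁻¹ • p z).re = (‖z‖ ^ 2)⁻¹ * (p z).re := by
          rw [Complex.smul_re, smul_eq_mul]
        simp only [h1]
        have h3 : 0 ≤ (‖z‖ ^ 2)⁻¹ * ‖p z‖ ^ 2 := by positivity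
        simp only [h2]
        nlinarith

/-- Change of variables for the logarithmic area element. -/
theorem lintegral_image_inv_norm_sq {S : Set ℂ} (hS : MeasurableSet S) {k k' : ℂ → ℂ}
    (hk : ∀ z ∈ S, HasDerivAt k (k' z) z) (hinj : InjOn k S) :
    ∫⁻ w in k '' S, ENNReal.ofReal ((‖w‖ ^ 2)⁻¹) =
      ∫⁻ z in S, ENNReal.ofReal (‖k' z / k z‖ ^ 2) := by
  rw [lintegral_image_eq_lintegral_abs_det_fderiv_mul volume hS
    (fun z hz => ((hk z hz).hasFDerivAt.restrictScalars ℝ).hasFDerivWithinAt) hinj]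
  refine setLIntegral_congr_fun hS fun z _ => ?_
  have : |((ContinuousLinearMap.toSpanSingleton ℂ (k' z)).restrictScalars ℝ).det| =
      ‖k' z‖ ^ 2 := by
    simp [ContinuousLinearMap.det, LinearMap.det_restrictScalars, Algebra.norm_complex_eq,
      Complex.normSq_eq_norm_sq]
  rw [this, ← ENNReal.ofReal_mul (by positivity), norm_div, div_pow, div_eq_mul_inv]

/-- A univalent function `k` on a neighbourhood of the closed unit disc with `k 0 = 0` and
`k z * k w ≠ 1` for all `z` and `w` satisfies `|k'(0)| ≤ 1`. -/
theorem norm_deriv_zero_le_one_of_mul_ne_one {R : ℝ} (hR : 1 < R) {k : ℂ → ℂ}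
    (hk : DifferentiableOn ℂ k (ball 0 R)) (hinj : InjOn k (ball 0 R)) (hk0 : k 0 = 0)
    (hmul : ∀ z ∈ ball (0 : ℂ) R, ∀ w ∈ ball (0 : ℂ) R, k z * k w ≠ 1) (hk' : deriv k 0 ≠ 0) :
    ‖deriv k 0‖ ≤ 1 := by
  by_contra! hlt
  obtain ⟨β, hβ1, hβ⟩ := exists_between hlt
  have hR0 : (0 : ℂ) ∈ ball (0 : ℂ) R := by simp; linarith
  have hne : ∀ z ∈ ball (0 : ℂ) R, z ≠ 0 → k z ≠ 0 := fun z hz h0 h =>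
    h0 (hinj hz hR0 (h.trans hk0.symm))
  -- a small disc whose image contains a larger disc
  obtain ⟨r, hr, hr1, hball⟩ : ∃ r, 0 < r ∧ r < 1 ∧ ball (0 : ℂ) (β * r) ⊆ k '' ball 0 r := by
    have hs : HasStrictDerivAt k (deriv k 0) 0 :=
      ((hk.analyticAt (isOpen_ball.mem_nhds hR0)).contDiffAt (n := 1)).hasStrictDerivAt
        (by simp)
    set g := hs.localInverse k _ _ hk' with hg
    have hg' : HasStrictDerivAt g (deriv k 0)⁻¹ (k 0) := hs.to_localInverse hk'
    have hgk : ∀ᶠ w in 𝓝 (k 0), k (g w) = w :=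
      (hs.hasStrictFDerivAt_equiv hk').eventually_right_inverse
    have hg0 : g (k 0) = 0 := (hs.hasStrictFDerivAt_equiv hk').localInverse_apply_image
    rw [hk0] at hg' hgk hg0
    have hb : ∀ᶠ w in 𝓝 (0 : ℂ), ‖g w‖ ≤ β⁻¹ * ‖w‖ := by
      have hc : ‖(deriv k 0)⁻¹‖ < β⁻¹ := by
        rw [norm_inv]
        exact inv_strictAnti₀ (by linarith) hβ
      have := hg'.hasDerivAt.hasFDerivAt.isLittleO
      have := (Asymptotics.isLittleO_iff.1 this) (sub_pos.2 hc)
      filter_upwards [this] with w hw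
      simp only [hg0, sub_zero, ContinuousLinearMap.toSpanSingleton_apply, smul_eq_mul] at hw
      have h1 : ‖g w‖ ≤ ‖g w - w * (deriv k 0)⁻¹‖ + ‖w * (deriv k 0)⁻¹‖ := by
        simpa using norm_add_le (g w - w * (deriv k 0)⁻¹) (w * (deriv k 0)⁻¹)
      rw [norm_mul] at h1
      nlinarith
    obtain ⟨ε, hε, hεb⟩ := Metric.eventually_nhds_iff_ball.1 (hb.and hgk)
    refine ⟨min (1 / 2) (ε / β), by positivity, (min_le_left _ _).trans_lt (by norm_num), ?_⟩
    intro w hw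
    rw [mem_ball_zero_iff] at hw
    have hβ0 : 0 < β := by linarith
    have hwε : w ∈ ball (0 : ℂ) ε := by
      rw [mem_ball_zero_iff]
      refine hw.trans_le ?_
      calc β * min (1 / 2) (ε / β) ≤ β * (ε / β) := by gcongr; exact min_le_right _ _
        _ = ε := by field_simp
    obtain ⟨h1, h2⟩ := hεb w hwε
    refine ⟨g w, ?_, h2⟩
    rw [mem_ball_zero_iff]
    calc ‖g w‖ ≤ β⁻¹ * ‖w‖ := h1
      _ < β⁻¹ * (β * min (1 / 2) (ε / β)) := by gcongr
      _ = _ := by field_simp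
  set A := closedBall (0 : ℂ) 1 \ ball 0 r with hA
  have hAm : MeasurableSet A := measurableSet_closedBall.diff measurableSet_ball
  have hAR : A ⊆ ball 0 R := sdiff_subset.trans (closedBall_subset_ball hR)
  have hrR : ball (0 : ℂ) r ⊆ ball 0 R := ball_subset_ball (by linarith)
  have hA0 : ∀ z ∈ A, z ≠ 0 := by
    rintro z hz rfl
    exact hz.2 (mem_ball_self hr)
  have hkA : ∀ z ∈ A, k z ≠ 0 := fun z hz => hne z (hAR hz) (hA0 z hz)
  have hder : ∀ z ∈ A, HasDerivAt k (deriv k z) z := fun z hz =>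
    (hk.differentiableAt (isOpen_ball.mem_nhds (hAR hz))).hasDerivAt
  set B := closedBall (0 : ℂ) 1 \ ball 0 (β * r) with hB
  set S₁ := A ∩ {z | ‖k z‖ ≤ 1} with hS₁
  set S₂ := A \ {z | ‖k z‖ ≤ 1} with hS₂
  have hS₁m : MeasurableSet S₁ := by
    have hc : IsClosed S₁ := (hk.continuousOn.mono hAR).norm.preimage_isClosed_of_isClosed
      ((isClosed_closedBall).sdiff isOpen_ball) isClosed_Iic
    exact hc.measurableSet
  have hS₂m : MeasurableSet S₂ := by
    have : S₂ = A \ S₁ := by rw [hS₁, sdiff_self_inter]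
    rw [this]
    exact hAm.diff hS₁m
  have hI₁ := lintegral_image_inv_norm_sq (k := k) (k' := deriv k) hS₁m
    (fun z hz => hder z hz.1) (hinj.mono (inter_subset_left.trans hAR))
  have hI₂ := lintegral_image_inv_norm_sq (k := fun z => (k z)⁻¹)
    (k' := fun z => -deriv k z / k z ^ 2) hS₂m
    (fun z hz => (hder z hz.1).inv (hkA z hz.1))
    (fun z hz w hw h => hinj (hAR hz.1) (hAR hw.1) (inv_injective h))
  have hI₂' : ∫⁻ z in S₂, ENNReal.ofReal (‖-deriv k z / k z ^ 2 / (k z)⁻¹‖ ^ 2) =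
      ∫⁻ z in S₂, ENNReal.ofReal (‖deriv k z / k z‖ ^ 2) := by
    refine setLIntegral_congr_fun hS₂m fun z hz => ?_
    have hkz := hkA z hz.1
    have : -deriv k z / k z ^ 2 / (k z)⁻¹ = -(deriv k z / k z) := by field_simp
    rw [this, norm_neg]
  rw [hI₂'] at hI₂
  have hsum : ∫⁻ z in A, ENNReal.ofReal (‖deriv k z / k z‖ ^ 2) =
      ∫⁻ w in k '' S₁ ∪ (fun z => (k z)⁻¹) '' S₂, ENNReal.ofReal ((‖w‖ ^ 2)⁻¹) := by
    have hm₂ : MeasurableSet ((fun z => (k z)⁻¹) '' S₂) := by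
      refine hS₂m.image_of_continuousOn_injOn ?_ ?_
      · exact (hk.continuousOn.mono (sdiff_subset.trans hAR)).inv₀ fun z hz => hkA z hz.1
      · exact fun z hz w hw h => hinj (hAR hz.1) (hAR hw.1) (inv_injective h)
    rw [lintegral_union hm₂, hI₁, hI₂, ← lintegral_union hS₂m]
    · rw [hS₁, hS₂, inter_union_sdiff]
    · exact disjoint_sdiff_inter.symm
    · rw [disjoint_left]
      rintro _ ⟨z, hz, rfl⟩ ⟨w, hw, h⟩
      refine hmul z (hAR hz.1) w (hAR hw.1) ?_
      simp only at h
      rw [← h, inv_mul_cancel₀ (hkA w hw.1)]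
  have hsub : k '' S₁ ∪ (fun z => (k z)⁻¹) '' S₂ ⊆ B := by
    rintro _ (⟨z, hz, rfl⟩ | ⟨z, hz, rfl⟩)
    · refine ⟨by simpa using hz.2, fun h => ?_⟩
      obtain ⟨w, hw, hwz⟩ := hball h
      exact hz.1.2 (hinj (hrR hw) (hAR hz.1) hwz ▸ hw)
    · have h1 : 1 < ‖k z‖ := by simpa using hz.2
      refine ⟨?_, fun h => ?_⟩
      · rw [mem_closedBall_zero_iff, norm_inv]
        exact inv_le_one_of_one_le₀ h1.le
      · obtain ⟨w, hw, hwz⟩ := hball h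
        exact hmul w (hrR hw) z (hAR hz.1) (by rw [hwz, inv_mul_cancel₀ (hkA z hz.1)])
  have hmain : ∫⁻ z in A, ENNReal.ofReal ((‖z‖ ^ 2)⁻¹) ≤
      ∫⁻ z in B, ENNReal.ofReal ((‖z‖ ^ 2)⁻¹) :=
    (lintegral_annulus_le_lintegral_logDeriv hR hr hk hk0 hk' hne).trans
      (hsum.le.trans (lintegral_mono_set hsub))
  -- but the second annulus is strictly smaller
  have hrβ : r < β * r := by nlinarith
  set T := ball (0 : ℂ) (min 1 (β * r)) \ closedBall 0 r with hT
  have hTo : IsOpen T := isOpen_ball.sdiff isClosed_closedBall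
  have hTne : T.Nonempty := by
    obtain ⟨t, ht1, ht2⟩ := exists_between (lt_min hr1 hrβ)
    refine ⟨(t : ℂ), ?_⟩
    have : ‖(t : ℂ)‖ = t := by
      rw [Complex.norm_real, Real.norm_of_nonneg (hr.le.trans ht1.le)]
    simp only [hT, mem_sdiff, mem_ball_zero_iff, mem_closedBall_zero_iff, this, not_le]
    exact ⟨ht2, ht1⟩
  have hTpos : 0 < ∫⁻ z in T, ENNReal.ofReal ((‖z‖ ^ 2)⁻¹) := by
    rw [setLIntegral_pos_iff (by fun_prop)]
    refine (hTo.measure_pos volume hTne).trans_le (measure_mono fun z hz => ⟨?_, hz⟩)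
    have : 0 < ‖z‖ := hr.trans (by simpa using hz.2)
    simp only [Function.mem_support, ne_eq, ENNReal.ofReal_eq_zero, not_le]
    positivity
  have hTB : Disjoint B T := by
    rw [disjoint_left]
    intro z hzB hzT
    exact hzB.2 (ball_subset_ball (min_le_right _ _) hzT.1)
  have hTA : B ∪ T ⊆ A := by
    rintro z (hz | hz)
    · exact ⟨hz.1, fun h => hz.2 (ball_subset_ball hrβ.le h)⟩
    · exact ⟨ball_subset_closedBall (ball_subset_ball (min_le_left _ _) hz.1),
        fun h => hz.2 (ball_subset_closedBall h)⟩
  have hfin : ∫⁻ z in B, ENNReal.ofReal ((‖z‖ ^ 2)⁻¹) ≠ ⊤ := by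
    refine (setLIntegral_lt_top_of_le_nnreal ?_ ⟨Real.toNNReal (((β * r) ^ 2)⁻¹), fun z hz => ?_⟩).ne
    · exact ((measure_mono sdiff_subset).trans_lt measure_closedBall_lt_top).ne
    · have h1 : β * r ≤ ‖z‖ := by simpa using hz.2
      have h2 : 0 < β * r := hr.trans hrβ
      refine ENNReal.ofReal_le_ofReal ?_
      gcongr
  have := (lintegral_mono_set hTA).trans hmain
  rw [lintegral_union hTo.measurableSet hTB] at this
  exact absurd this (not_le.2 (ENNReal.lt_add_right hfin (pos_iff_ne_zero.1 hTpos)))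

/-- If every nonvanishing continuous function on the open set `U` has a continuous logarithm, then
every nonvanishing holomorphic function on `U` has a holomorphic square root, and its value at one
point can be prescribed. -/
theorem exists_hasDerivAt_sq_eq {U : Set ℂ} (hU : IsOpen U)
    (hlog : ∀ F : ℂ → ℂ, ContinuousOn F U → (∀ u ∈ U, F u ≠ 0) →
      ∃ M : ℂ → ℂ, ContinuousOn M U ∧ ∀ u ∈ U, exp (M u) = F u)
    {F : ℂ → ℂ} (hF : DifferentiableOn ℂ F U) (hF0 : ∀ u ∈ U, F u ≠ 0)
    {u₀ c : ℂ} (hu₀ : u₀ ∈ U) (hc : c ^ 2 = F u₀) :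
    ∃ s : ℂ → ℂ, s u₀ = c ∧ (∀ u ∈ U, s u ^ 2 = F u) ∧
      ∀ u ∈ U, HasDerivAt s (deriv F u / (2 * s u)) u := by
  obtain ⟨M, hMc, hM⟩ := hlog F hF.continuousOn hF0
  obtain ⟨s, hs₀, hsc, hs⟩ : ∃ s : ℂ → ℂ, s u₀ = c ∧ ContinuousOn s U ∧ ∀ u ∈ U, s u ^ 2 = F u := by
    have h1 : ContinuousOn (fun u => exp (M u / 2)) U := (hMc.div_const 2).cexp
    have h2 : ∀ u ∈ U, exp (M u / 2) ^ 2 = F u := fun u hu => by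
      rw [← hM u hu, ← Complex.exp_nat_mul]
      congr 1
      push_cast
      ring
    rcases sq_eq_sq_iff_eq_or_eq_neg.1 ((h2 u₀ hu₀).trans hc.symm) with h | h
    · exact ⟨_, h, h1, h2⟩
    · exact ⟨fun u => -exp (M u / 2), by simp only [h, neg_neg], h1.neg, fun u hu => by
        rw [neg_sq, h2 u hu]⟩
  refine ⟨s, hs₀, hs, fun u hu => ?_⟩
  have hsu : s u ≠ 0 := fun h => hF0 u hu (by rw [← hs u hu, h]; simp)
  have hFd : HasDerivAt F (deriv F u) u :=
    (hF.differentiableAt (hU.mem_nhds hu)).hasDerivAt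
  rw [hasDerivAt_iff_tendsto_slope] at hFd ⊢
  have hsu' : Filter.Tendsto (fun v => s v + s u) (𝓝[≠] u) (𝓝 (2 * s u)) := by
    have := ((hsc.continuousAt (hU.mem_nhds hu)).tendsto.add_const (s u)).mono_left
      (nhdsWithin_le_nhds (s := {u}ᶜ))
    rwa [← two_mul] at this
  have h2 : 2 * s u ≠ 0 := mul_ne_zero two_ne_zero hsu
  refine (hFd.div hsu' h2).congr' ?_
  filter_upwards [hsu'.eventually_ne h2, nhdsWithin_le_nhds (hU.mem_nhds hu),
    self_mem_nhdsWithin] with v hv hvU hvu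
  have hvu' : v - u ≠ 0 := sub_ne_zero.2 hvu
  simp only [Pi.div_apply, slope_def_field]
  rw [← hs v hvU, ← hs u hu]
  field_simp
  ring

/-- The disc automorphism exchanging `p` and the origin up to sign. -/
def discAut (p w : ℂ) : ℂ := (w - p) / (1 - (starRingEnd ℂ) p * w)

theorem one_sub_conj_mul_ne_zero {p w : ℂ} (hp : ‖p‖ < 1) (hw : ‖w‖ < 1) :
    1 - (starRingEnd ℂ) p * w ≠ 0 := by
  intro h
  have : ‖(starRingEnd ℂ) p * w‖ = 1 := by rw [← sub_eq_zero.1 h, norm_one]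
  rw [norm_mul, RCLike.norm_conj] at this
  nlinarith [norm_nonneg p, norm_nonneg w]

theorem norm_discAut_lt_one {p w : ℂ} (hp : ‖p‖ < 1) (hw : ‖w‖ < 1) : ‖discAut p w‖ < 1 := by
  have h0 := one_sub_conj_mul_ne_zero hp hw
  rw [discAut, norm_div, div_lt_one (norm_pos_iff.2 h0)]
  refine lt_of_pow_lt_pow_left₀ 2 (norm_nonneg _) ?_
  have h1 : ‖p‖ ^ 2 < 1 := by nlinarith [norm_nonneg p]
  have h2 : ‖w‖ ^ 2 < 1 := by nlinarith [norm_nonneg w]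
  rw [← Complex.normSq_eq_norm_sq, Complex.normSq_apply] at h1 h2 ⊢
  rw [← Complex.normSq_eq_norm_sq, Complex.normSq_apply]
  simp
  nlinarith [mul_pos (sub_pos.2 h1) (sub_pos.2 h2)]

theorem discAut_injOn {p : ℂ} (hp : ‖p‖ < 1) : InjOn (discAut p) (ball 0 1) := by
  intro w hw v hv h
  rw [mem_ball_zero_iff] at hw hv
  have h1 := one_sub_conj_mul_ne_zero hp hw
  have h2 := one_sub_conj_mul_ne_zero hp hv
  have h3 := one_sub_conj_mul_ne_zero hp hp
  rw [discAut, discAut, div_eq_div_iff h1 h2] at h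
  refine mul_left_cancel₀ h3 ?_
  linear_combination h

theorem hasDerivAt_discAut {p w : ℂ} (hp : ‖p‖ < 1) (hw : ‖w‖ < 1) :
    HasDerivAt (discAut p)
      ((1 - (starRingEnd ℂ) p * p) / (1 - (starRingEnd ℂ) p * w) ^ 2) w := by
  have h1 := one_sub_conj_mul_ne_zero hp hw
  have := ((hasDerivAt_id w).sub_const p).div
    (((hasDerivAt_id w).const_mul ((starRingEnd ℂ) p)).const_sub 1) h1
  refine this.congr_deriv ?_
  simp
  ring

/-- Holomorphic injections of `U` into the unit disc fixing the origin, with nonvanishing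
derivative. -/
structure IsNormalizedUnivalent (U : Set ℂ) (f : ℂ → ℂ) : Prop where
  differentiableOn : DifferentiableOn ℂ f U
  mapsTo : MapsTo f U (ball 0 1)
  injOn : InjOn f U
  map_zero : f 0 = 0
  deriv_ne_zero : ∀ u ∈ U, deriv f u ≠ 0

/-- The square-root trick: a normalized univalent function omitting a value of the disc can be
modified so as to increase its derivative at the origin. -/
theorem IsNormalizedUnivalent.exists_norm_deriv_eq {U : Set ℂ} (hU : IsOpen U)
    (hlog : ∀ F : ℂ → ℂ, ContinuousOn F U → (∀ u ∈ U, F u ≠ 0) →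
      ∃ M : ℂ → ℂ, ContinuousOn M U ∧ ∀ u ∈ U, exp (M u) = F u)
    (h0 : (0 : ℂ) ∈ U) {f : ℂ → ℂ} (hf : IsNormalizedUnivalent U f) {p : ℂ} (hp : ‖p‖ < 1)
    (hpf : p ∉ f '' U) :
    ∃ g : ℂ → ℂ, IsNormalizedUnivalent U g ∧
      ‖deriv g 0‖ = ‖deriv f 0‖ * ((1 + ‖p‖) / (2 * √‖p‖)) := by
  have hfu : ∀ u ∈ U, ‖f u‖ < 1 := fun u hu => by simpa using hf.mapsTo hu
  have hp0 : p ≠ 0 := by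
    rintro rfl
    exact hpf ⟨0, h0, hf.map_zero⟩
  have hFd : ∀ u ∈ U, HasDerivAt (fun u => discAut p (f u))
      ((1 - (starRingEnd ℂ) p * p) / (1 - (starRingEnd ℂ) p * f u) ^ 2 * deriv f u) u :=
    fun u hu => (hasDerivAt_discAut hp (hfu u hu)).comp u
      (hf.differentiableOn.differentiableAt (hU.mem_nhds hu)).hasDerivAt
  have hF0 : ∀ u ∈ U, discAut p (f u) ≠ 0 := fun u hu h => by
    rw [discAut, div_eq_zero_iff, sub_eq_zero] at h
    rcases h with h | h
    · exact hpf ⟨u, hu, h⟩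
    · exact one_sub_conj_mul_ne_zero hp (hfu u hu) h
  obtain ⟨κ, hκ⟩ : ∃ κ : ℂ, κ ^ 2 = discAut p (f 0) :=
    IsAlgClosed.exists_pow_nat_eq _ two_pos
  obtain ⟨s, hs0, hs, hsd⟩ := exists_hasDerivAt_sq_eq hU hlog
    (fun u hu => (hFd u hu).differentiableAt.differentiableWithinAt) hF0 h0 hκ
  have hsn : ∀ u ∈ U, ‖s u‖ < 1 := fun u hu => by
    have := norm_discAut_lt_one hp (hfu u hu)
    rw [← hs u hu, norm_pow] at this
    exact (sq_lt_one_iff₀ (norm_nonneg _)).1 this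
  have hs0' : ∀ u ∈ U, s u ≠ 0 := fun u hu h => hF0 u hu (by rw [← hs u hu, h]; simp)
  have hκn : ‖κ‖ < 1 := hs0 ▸ hsn 0 h0
  have hκp : ‖κ‖ ^ 2 = ‖p‖ := by
    rw [← norm_pow, hκ, hf.map_zero]
    simp [discAut]
  have hconj : ∀ q : ℂ, (starRingEnd ℂ) q * q = ((‖q‖ ^ 2 : ℝ) : ℂ) := fun q => by
    rw [mul_comm, Complex.mul_conj, Complex.normSq_eq_norm_sq]
  have hgd : ∀ u ∈ U, HasDerivAt (fun u => discAut κ (s u))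
      ((1 - (starRingEnd ℂ) κ * κ) / (1 - (starRingEnd ℂ) κ * s u) ^ 2 *
        ((1 - (starRingEnd ℂ) p * p) / (1 - (starRingEnd ℂ) p * f u) ^ 2 * deriv f u /
          (2 * s u))) u := fun u hu => by
    refine (hasDerivAt_discAut hκn (hsn u hu)).comp u ?_
    rw [← (hFd u hu).deriv]
    exact hsd u hu
  refine ⟨fun u => discAut κ (s u), ⟨fun u hu => ?_, fun u hu => ?_, ?_, ?_, fun u hu => ?_⟩, ?_⟩
  · exact (hgd u hu).differentiableAt.differentiableWithinAt
  · simpa using norm_discAut_lt_one hκn (hsn u hu)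
  · intro u hu v hv h
    have h1 := discAut_injOn hκn (by simpa using hsn u hu) (by simpa using hsn v hv) h
    have h2 : discAut p (f u) = discAut p (f v) := by rw [← hs u hu, ← hs v hv, h1]
    exact hf.injOn hu hv (discAut_injOn hp (hf.mapsTo hu) (hf.mapsTo hv) h2)
  · simp [discAut, hs0]
  · rw [(hgd u hu).deriv]
    have h1 := one_sub_conj_mul_ne_zero hκn hκn
    have h2 := one_sub_conj_mul_ne_zero hκn (hsn u hu)
    have h3 := one_sub_conj_mul_ne_zero hp hp
    have h4 := one_sub_conj_mul_ne_zero hp (hfu u hu)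
    have h5 := hf.deriv_ne_zero u hu
    have h6 := hs0' u hu
    exact mul_ne_zero (div_ne_zero h1 (pow_ne_zero _ h2)) (div_ne_zero
      (mul_ne_zero (div_ne_zero h3 (pow_ne_zero _ h4)) h5) (mul_ne_zero two_ne_zero h6))
  · rw [(hgd 0 h0).deriv, hs0, hf.map_zero, mul_zero, sub_zero, hconj, hconj, hκp]
    have hps : √‖p‖ = ‖κ‖ := by rw [← hκp, Real.sqrt_sq (norm_nonneg _)]
    rw [hps]
    have hκ0 : 0 < ‖κ‖ := norm_pos_iff.2 (hs0 ▸ hs0' 0 h0)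
    have h1 : (1 : ℂ) - ((‖p‖ : ℝ) : ℂ) = ((1 - ‖p‖ : ℝ) : ℂ) := by push_cast; ring
    have h2 : (1 : ℂ) - ((‖p‖ ^ 2 : ℝ) : ℂ) = ((1 - ‖p‖ ^ 2 : ℝ) : ℂ) := by push_cast; ring
    rw [h1, h2]
    have h3 : 0 < 1 - ‖p‖ := by linarith
    have h4 : 0 < 1 - ‖p‖ ^ 2 := by nlinarith [norm_nonneg p]
    simp only [norm_mul, norm_div, norm_pow, Complex.norm_real, Real.norm_of_nonneg h3.le,
      Real.norm_of_nonneg h4.le, norm_one, Complex.norm_ofNat]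
    field_simp
    ring

theorem map_nhds_eq_of_deriv_ne_zero {U : Set ℂ} (hU : IsOpen U) {f : ℂ → ℂ}
    (hf : DifferentiableOn ℂ f U) {u : ℂ} (hu : u ∈ U) (hne : deriv f u ≠ 0) :
    Filter.map f (𝓝 u) = 𝓝 (f u) :=
  (((hf.analyticAt (hU.mem_nhds hu)).contDiffAt (n := 1)).hasStrictDerivAt
    (by simp)).map_nhds_eq hne

/-- The inverse of a holomorphic injection with nonvanishing derivative is holomorphic. -/
theorem hasDerivAt_invFunOn {U : Set ℂ} (hU : IsOpen U) {f : ℂ → ℂ}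
    (hf : DifferentiableOn ℂ f U) (hinj : InjOn f U) {u : ℂ} (hu : u ∈ U) (hf' : deriv f u ≠ 0) :
    HasDerivAt (Function.invFunOn f U) (deriv f u)⁻¹ (f u) := by
  have hgu : Function.invFunOn f U (f u) = u := hinj.leftInvOn_invFunOn hu
  have hnhds := map_nhds_eq_of_deriv_ne_zero hU hf hu hf'
  refine HasDerivAt.of_local_left_inverse (f := f) ?_ ?_ hf' ?_
  · rw [ContinuousAt, hgu, ← hnhds, Filter.tendsto_map'_iff]
    refine Filter.Tendsto.congr' ?_ Filter.tendsto_id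
    filter_upwards [hU.mem_nhds hu] with v hv
    exact (hinj.leftInvOn_invFunOn hv).symm
  · rw [hgu]
    exact (hf.differentiableAt (hU.mem_nhds hu)).hasDerivAt
  · rw [← hnhds, Filter.eventually_map]
    filter_upwards [hU.mem_nhds hu] with v hv
    rw [hinj.leftInvOn_invFunOn hv]

/-- If `U` contains the origin but not `1` and admits continuous logarithms, then the Cayley
transform of a branch of `√(1 - u)` is univalent on `U`, and its image never contains a point
together with its reciprocal. -/
theorem exists_univalent_mul_ne_one {U : Set ℂ} (hU : IsOpen U)
    (hlog : ∀ F : ℂ → ℂ, ContinuousOn F U → (∀ u ∈ U, F u ≠ 0) →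
      ∃ M : ℂ → ℂ, ContinuousOn M U ∧ ∀ u ∈ U, exp (M u) = F u)
    (h0 : (0 : ℂ) ∈ U) (h1 : (1 : ℂ) ∉ U) :
    ∃ τ : ℂ → ℂ, DifferentiableOn ℂ τ U ∧ InjOn τ U ∧ τ 0 = 0 ∧ (∀ u ∈ U, deriv τ u ≠ 0) ∧
      ‖deriv τ 0‖ = 1 / 4 ∧ ∀ u ∈ U, ∀ v ∈ U, τ u * τ v ≠ 1 := by
  have hF0 : ∀ u ∈ U, (1 : ℂ) - u ≠ 0 := fun u hu h => h1 (by rwa [sub_eq_zero.1 h])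
  obtain ⟨s, hs0, hs, hsd⟩ := exists_hasDerivAt_sq_eq hU hlog (F := fun u => 1 - u) (c := 1)
    (by fun_prop) hF0 h0 (by simp)
  have hsne : ∀ u ∈ U, s u ≠ 0 := fun u hu h => hF0 u hu (by rw [← hs u hu, h]; simp)
  have hs_eq : ∀ u ∈ U, ∀ v ∈ U, s u ^ 2 = s v ^ 2 → u = v := fun u hu v hv h => by
    rw [hs u hu, hs v hv] at h
    exact sub_right_injective h
  have hs1 : ∀ u ∈ U, s u + 1 ≠ 0 := fun u hu h => by
    have h2 : s u = -1 := eq_neg_of_add_eq_zero_left h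
    have h3 : u = 0 := hs_eq u hu 0 h0 (by rw [h2, hs0]; norm_num)
    rw [h3, hs0] at h2
    norm_num at h2
  have hd : ∀ u ∈ U, HasDerivAt (fun u => (s u - 1) / (s u + 1))
      (-(s u * (s u + 1) ^ 2)⁻¹) u := fun u hu => by
    have h2 : HasDerivAt s (-1 / (2 * s u)) u := by
      have h3 := hsd u hu
      rwa [((hasDerivAt_id' u).const_sub 1).deriv] at h3
    refine ((h2.sub_const 1).div (h2.add_const 1) (hs1 u hu)).congr_deriv ?_
    have := hsne u hu
    have := hs1 u hu
    field_simp
    ring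
  refine ⟨fun u => (s u - 1) / (s u + 1),
    fun u hu => (hd u hu).differentiableAt.differentiableWithinAt, fun u hu v hv h => ?_,
    by simp [hs0], fun u hu => ?_, ?_, fun u hu v hv h => ?_⟩
  · simp only at h
    rw [div_eq_div_iff (hs1 u hu) (hs1 v hv)] at h
    refine hs_eq u hu v hv ?_
    rw [show s u = s v by linear_combination h / 2]
  · rw [(hd u hu).deriv]
    exact neg_ne_zero.2 (inv_ne_zero (mul_ne_zero (hsne u hu) (pow_ne_zero _ (hs1 u hu))))
  · rw [(hd 0 h0).deriv, hs0]
    norm_num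
  · simp only at h
    rw [div_mul_div_comm, div_eq_one_iff_eq (mul_ne_zero (hs1 u hu) (hs1 v hv))] at h
    have h2 : s u = -s v := by linear_combination -h / 2
    have h3 : u = v := hs_eq u hu v hv (by rw [h2, neg_sq])
    subst h3
    exact hsne u hu (self_eq_neg.1 h2)

/-- A form of the Koebe quarter theorem: if `U` contains the origin but not `1` and admits
continuous logarithms, then there are holomorphic maps from `U` to the unit disc fixing the origin
whose derivative there is arbitrarily close to `1 / 4` or larger. -/
theorem exists_mapsTo_ball_norm_deriv_ge {U : Set ℂ} (hU : IsOpen U)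
    (hlog : ∀ F : ℂ → ℂ, ContinuousOn F U → (∀ u ∈ U, F u ≠ 0) →
      ∃ M : ℂ → ℂ, ContinuousOn M U ∧ ∀ u ∈ U, exp (M u) = F u)
    (h0 : (0 : ℂ) ∈ U) (h1 : (1 : ℂ) ∉ U) {t : ℝ} (ht : t < 1) :
    ∃ f : ℂ → ℂ, DifferentiableOn ℂ f U ∧ MapsTo f U (ball 0 1) ∧ f 0 = 0 ∧
      t / 4 ≤ ‖deriv f 0‖ := by
  wlog ht0 : 0 < t generalizing t
  · obtain ⟨f, hf1, hf2, hf3, hf4⟩ := this (t := 1 / 2) (by norm_num) (by norm_num)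
    exact ⟨f, hf1, hf2, hf3, by linarith⟩
  obtain ⟨τ, hτd, hτi, hτ0, hτ', hτ4, hτm⟩ := exists_univalent_mul_ne_one hU hlog h0 h1
  set N := {r : ℝ | ∃ f, IsNormalizedUnivalent U f ∧ r = ‖deriv f 0‖} with hN
  have hbdd : BddAbove N := by
    obtain ⟨ε, hε, hεU⟩ := Metric.isOpen_iff.1 hU 0 h0
    refine ⟨1 / ε, ?_⟩
    rintro _ ⟨f, hf, rfl⟩
    refine Complex.norm_deriv_le_div_of_mapsTo_ball (hf.differentiableOn.mono hεU) ?_ hε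
    rw [hf.map_zero]
    exact (hf.mapsTo.mono_left hεU).mono_right ball_subset_closedBall
  obtain ⟨f₀, hf₀⟩ : ∃ f, IsNormalizedUnivalent U f := by
    have hopen : τ '' U ∈ 𝓝 (0 : ℂ) := by
      rw [← hτ0, ← map_nhds_eq_of_deriv_ne_zero hU hτd h0 (hτ' 0 h0)]
      exact Filter.image_mem_map (hU.mem_nhds h0)
    obtain ⟨δ, hδ, hδU⟩ := Metric.mem_nhds_iff.1 hopen
    have hb : ∀ u ∈ U, ‖τ u‖ ≤ δ⁻¹ := fun u hu => by
      by_contra! hlt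
      have hpos : 0 < ‖τ u‖ := (inv_pos.2 hδ).trans hlt
      have hmem : (τ u)⁻¹ ∈ ball (0 : ℂ) δ := by
        rw [mem_ball_zero_iff, norm_inv]
        exact inv_lt_of_inv_lt₀ hδ hlt
      obtain ⟨v, hv, hvu⟩ := hδU hmem
      exact hτm u hu v hv (by rw [hvu, mul_inv_cancel₀ (norm_pos_iff.1 hpos)])
    have hc : ((δ / 2 : ℝ) : ℂ) ≠ 0 := by
      rw [Ne, Complex.ofReal_eq_zero]
      positivity
    refine ⟨fun u => ((δ / 2 : ℝ) : ℂ) * τ u, hτd.const_mul _, fun u hu => ?_, fun u hu v hv h => ?_,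
      by simp [hτ0], fun u hu => ?_⟩
    · rw [mem_ball_zero_iff, norm_mul, Complex.norm_real, Real.norm_of_nonneg (by positivity)]
      calc δ / 2 * ‖τ u‖ ≤ δ / 2 * δ⁻¹ := by gcongr; exact hb u hu
        _ = 1 / 2 := by field_simp
        _ < 1 := by norm_num
    · exact hτi hu hv (mul_left_cancel₀ hc h)
    · rw [deriv_const_mul_field]
      exact mul_ne_zero hc (hτ' u hu)
  have hSpos : 0 < sSup N :=
    (norm_pos_iff.2 (hf₀.deriv_ne_zero 0 h0)).trans_le (le_csSup hbdd ⟨f₀, hf₀, rfl⟩)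
  obtain ⟨ρ, htρ, hρ1⟩ := exists_between ht
  have hρ0 : 0 < ρ := ht0.trans htρ
  set r := √ρ with hr
  have hr0 : 0 < r := Real.sqrt_pos.2 hρ0
  have hrρ : r ^ 2 = ρ := Real.sq_sqrt hρ0.le
  have hr1 : r < 1 := by nlinarith
  have hK : 2 * r / (1 + r ^ 2) < 1 := by
    rw [div_lt_one (by positivity)]
    nlinarith [sq_pos_of_pos (sub_pos.2 hr1)]
  obtain ⟨_, ⟨f, hf, rfl⟩, hfS⟩ := exists_lt_of_lt_csSup (s := N) ⟨_, f₀, hf₀, rfl⟩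
    (show sSup N * (2 * r / (1 + r ^ 2)) < sSup N by nlinarith)
  have hcover : ball (0 : ℂ) ρ ⊆ f '' U := by
    intro p hp
    rw [mem_ball_zero_iff] at hp
    by_contra hpf
    obtain ⟨g, hg, hgn⟩ := hf.exists_norm_deriv_eq hU hlog h0 (hp.trans hρ1) hpf
    have hp0 : 0 < ‖p‖ := norm_pos_iff.2 (by rintro rfl; exact hpf ⟨0, h0, hf.map_zero⟩)
    set q := √‖p‖ with hq
    have hq0 : 0 < q := Real.sqrt_pos.2 hp0
    have hqp : q ^ 2 = ‖p‖ := Real.sq_sqrt hp0.le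
    have hqr : q < r := Real.sqrt_lt_sqrt hp0.le hp
    have hle : ‖deriv g 0‖ ≤ sSup N := le_csSup hbdd ⟨g, hg, rfl⟩
    rw [← hqp] at hgn
    have h2 : (1 + r ^ 2) / (2 * r) ≤ (1 + q ^ 2) / (2 * q) := by
      rw [div_le_div_iff₀ (by positivity) (by positivity)]
      nlinarith [mul_nonneg (sub_pos.2 hqr).le (show 0 ≤ 1 - r * q by nlinarith)]
    have h3 : sSup N < ‖deriv f 0‖ * ((1 + r ^ 2) / (2 * r)) := by
      rw [← mul_div_assoc, div_lt_iff₀ (by positivity)] at hfS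
      rw [← mul_div_assoc, lt_div_iff₀ (by positivity)]
      linarith
    have h4 : ‖deriv f 0‖ * ((1 + r ^ 2) / (2 * r)) ≤ ‖deriv f 0‖ * ((1 + q ^ 2) / (2 * q)) := by
      gcongr
    linarith
  refine ⟨f, hf.differentiableOn, hf.mapsTo, hf.map_zero, ?_⟩
  set g := Function.invFunOn f U with hg
  have hgU : ∀ w ∈ ball (0 : ℂ) ρ, g w ∈ U := fun w hw => Function.invFunOn_mem (hcover hw)
  have hfg : ∀ w ∈ ball (0 : ℂ) ρ, f (g w) = w := fun w hw => Function.invFunOn_eq (hcover hw)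
  have hgd : ∀ w ∈ ball (0 : ℂ) ρ, HasDerivAt g (deriv f (g w))⁻¹ w := fun w hw => by
    have := hasDerivAt_invFunOn hU hf.differentiableOn hf.injOn (hgU w hw)
      (hf.deriv_ne_zero _ (hgU w hw))
    rwa [hfg w hw] at this
  have hg0 : g 0 = 0 := by
    have := hf.injOn.leftInvOn_invFunOn h0
    rwa [hf.map_zero] at this
  have htn : ‖(t : ℂ)‖ = t := by rw [Complex.norm_real, Real.norm_of_nonneg ht0.le]
  have ht0' : (t : ℂ) ≠ 0 := Complex.ofReal_ne_zero.2 ht0.ne'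
  have hmem : ∀ z ∈ ball (0 : ℂ) (ρ / t), (t : ℂ) * z ∈ ball (0 : ℂ) ρ := fun z hz => by
    rw [mem_ball_zero_iff, lt_div_iff₀ ht0] at hz
    rwa [mem_ball_zero_iff, norm_mul, htn, mul_comm]
  have hkd : ∀ z ∈ ball (0 : ℂ) (ρ / t), HasDerivAt (fun z => τ (g (t * z)))
      (deriv τ (g (t * z)) * ((deriv f (g (t * z)))⁻¹ * t)) z := fun z hz => by
    have h2 : HasDerivAt (fun z : ℂ => (t : ℂ) * z) t z := by
      simpa using (hasDerivAt_id z).const_mul (t : ℂ)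
    have h3 := HasDerivAt.comp z (h₂ := g) (hgd _ (hmem z hz)) h2
    exact HasDerivAt.comp z (h₂ := τ)
      (hτd.differentiableAt (hU.mem_nhds (hgU _ (hmem z hz)))).hasDerivAt h3
  have hz0 : (0 : ℂ) ∈ ball (0 : ℂ) (ρ / t) := mem_ball_self (by positivity)
  have hfin := norm_deriv_zero_le_one_of_mul_ne_one (R := ρ / t) ((one_lt_div ht0).2 htρ)
    (k := fun z => τ (g (t * z)))
    (fun z hz => (hkd z hz).differentiableAt.differentiableWithinAt)
    (fun z hz w hw h => by
      have h2 := hτi (hgU _ (hmem z hz)) (hgU _ (hmem w hw)) h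
      have h3 := congrArg f h2
      rw [hfg _ (hmem z hz), hfg _ (hmem w hw)] at h3
      exact mul_left_cancel₀ ht0' h3)
    (by simp [hg0, hτ0])
    (fun z hz w hw => hτm _ (hgU _ (hmem z hz)) _ (hgU _ (hmem w hw)))
    (by
      rw [(hkd 0 hz0).deriv]
      have hmz := hgU _ (hmem 0 hz0)
      exact mul_ne_zero (hτ' _ hmz) (mul_ne_zero (inv_ne_zero (hf.deriv_ne_zero _ hmz)) ht0'))
  rw [(hkd 0 hz0).deriv, mul_zero, hg0, norm_mul, norm_mul, hτ4, norm_inv, htn] at hfin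
  have hfpos : 0 < ‖deriv f 0‖ := norm_pos_iff.2 (hf.deriv_ne_zero 0 h0)
  field_simp at hfin
  linarith

/-- Continuous logarithms exist on the image of an open `ℂ`-convex set under a nonzero affine
functional. -/
theorem IsCConvex.exists_continuousOn_log_image {n : ℕ} {D : Set (Cn n)} (hD : IsOpen D)
    (hcc : IsCConvex D) {z : Cn n} (hz : z ∈ D) {φ : Cn n →L[ℂ] ℂ} (hφ : Function.Surjective φ)
    {F : ℂ → ℂ} (hF : ContinuousOn F ((fun w => φ (w - z)) '' D))
    (hF0 : ∀ u ∈ (fun w => φ (w - z)) '' D, F u ≠ 0) :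
    ∃ M : ℂ → ℂ, ContinuousOn M ((fun w => φ (w - z)) '' D) ∧
      ∀ u ∈ (fun w => φ (w - z)) '' D, exp (M u) = F u := by
  set ℓ : Cn n → ℂ := fun w => φ (w - z) with hℓ
  have hℓc : Continuous ℓ := by fun_prop
  obtain ⟨L, hLc, hL⟩ := exists_continuousOn_log_of_slices hD z
    (fun w hw => hcc.isSimplyConnected_slice z (w - z) ⟨1, by simpa using hw⟩)
    (c := fun _ => 0) continuousOn_const (fun w _ => by simpa using hz)
    (g := fun w => F (ℓ w)) (hF.comp hℓc.continuousOn (mapsTo_image ℓ D))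
    (fun w hw => hF0 _ (mem_image_of_mem ℓ hw))
    (h := fun _ => log (F (ℓ z))) continuousOn_const
    (fun w _ => by simpa using exp_log (hF0 _ (mem_image_of_mem ℓ hz)))
  have hfib : ∀ w ∈ D, ∀ w' ∈ D, ℓ w = ℓ w' → L w = L w' := fun w hw w' hw' h => by
    have hS := hcc.isSimplyConnected_slice w (w' - w) ⟨0, by simpa using hw⟩
    have hline : ∀ l : ℂ, ℓ (w + l • (w' - w)) = ℓ w := fun l => by
      have h1 : φ w = φ w' := by simpa [hℓ] using h
      simp [hℓ, h1]
    have h1 := hS.isPathConnected.isConnected.isPreconnected.sub_eq_sub_of_exp_eq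
      (f := fun l : ℂ => L (w + l • (w' - w))) (g := fun _ => log (F (ℓ w))) (x := 0) (y := 1)
      (hLc.comp (by fun_prop) fun l hl => hl) continuousOn_const
      (fun l hl => by
        rw [hL _ hl, exp_log (hF0 _ (mem_image_of_mem ℓ hw)), hline])
      (by simpa using hw) (by simpa using hw')
    simpa using h1
  have hinv : ∀ w ∈ D, L (Function.invFunOn ℓ D (ℓ w)) = L w := fun w hw =>
    hfib _ (Function.invFunOn_mem ⟨w, hw, rfl⟩) w hw (Function.invFunOn_eq ⟨w, hw, rfl⟩)
  have hopen : IsOpenMap ℓ := (φ.isOpenMap hφ).comp (Homeomorph.subRight z).isOpenMap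
  refine ⟨fun u => L (Function.invFunOn ℓ D u), ?_, ?_⟩
  · rintro _ ⟨w, hw, rfl⟩
    refine ContinuousAt.continuousWithinAt ?_
    rw [ContinuousAt, hinv w hw]
    refine Filter.Tendsto.mono_left ?_ (hopen.nhds_le w)
    rw [Filter.tendsto_map'_iff]
    refine (hLc.continuousAt (hD.mem_nhds hw)).tendsto.congr' ?_
    filter_upwards [hD.mem_nhds hw] with w' hw'
    exact (hinv w' hw').symm
  · rintro _ ⟨w, hw, rfl⟩
    simp only [hinv w hw, hL w hw]

theorem bddAbove_caraMetric {n : ℕ} {D : Set (Cn n)} (hD : IsOpen D) {z : Cn n} (hz : z ∈ D)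
    (X : Cn n) :
    BddAbove {r : ℝ | ∃ f : Cn n → ℂ, DifferentiableOn ℂ f D ∧ MapsTo f D (ball (0 : ℂ) 1) ∧
      f z = 0 ∧ r = ‖fderiv ℂ f z X‖} := by
  obtain ⟨ε, hε, hεD⟩ := Metric.isOpen_iff.1 hD z hz
  refine ⟨1 / ε * ‖X‖, ?_⟩
  rintro _ ⟨f, hf, hfm, hf0, rfl⟩
  refine ((fderiv ℂ f z).le_opNorm X).trans ?_
  gcongr
  refine Complex.norm_fderiv_le_div_of_mapsTo_ball (hf.mono hεD) ?_ hε
  rw [hf0]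
  exact (hfm.mono_left hεD).mono_right ball_subset_closedBall

/-- A disc of radius `d` in direction `X` inside `D` bounds the Kobayashi metric by `1 / d`. -/
theorem kobMetric_le_inv {n : ℕ} {D : Set (Cn n)} {z X : Cn n} {d : ℝ} (hd : 0 < d)
    (hdD : ∀ l : ℂ, ‖l‖ < d → z + l • X ∈ D) : kobMetric D z X ≤ d⁻¹ := by
  refine csInf_le ⟨0, fun a ha => ha.1⟩ ⟨(inv_pos.2 hd).le,
    fun ζ => z + ζ • ((d : ℂ) • X), by fun_prop, fun ζ hζ => ?_, by simp, ?_⟩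
  · simp only [smul_smul]
    refine hdD _ ?_
    rw [mem_ball_zero_iff] at hζ
    rw [norm_mul, Complex.norm_real, Real.norm_of_nonneg hd.le]
    nlinarith
  · have h1 : HasDerivAt (fun ζ : ℂ => z + ζ • ((d : ℂ) • X)) ((1 : ℂ) • ((d : ℂ) • X)) 0 :=
      ((hasDerivAt_id (0 : ℂ)).smul_const _).const_add z
    rw [fderiv_apply_one_eq_deriv, h1.deriv, one_smul, ← Complex.coe_smul, smul_smul]
    push_cast
    rw [inv_mul_cancel₀ (Complex.ofReal_ne_zero.2 hd.ne'), one_smul]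

theorem caraMetric_nonneg {n : ℕ} (D : Set (Cn n)) (z X : Cn n) : 0 ≤ caraMetric D z X := by
  refine Real.sSup_nonneg ?_
  rintro _ ⟨f, -, -, -, rfl⟩
  exact norm_nonneg _

/-- A holomorphic map from the image of `D` under an affine functional to the unit disc bounds the
Carathéodory metric from below. -/
theorem norm_deriv_mul_le_caraMetric {n : ℕ} {D : Set (Cn n)} (hD : IsOpen D) {z : Cn n}
    (hz : z ∈ D) (X : Cn n) (φ : Cn n →L[ℂ] ℂ) (hU : IsOpen ((fun w => φ (w - z)) '' D))
    {f : ℂ → ℂ} (hf : DifferentiableOn ℂ f ((fun w => φ (w - z)) '' D))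
    (hfm : MapsTo f ((fun w => φ (w - z)) '' D) (ball 0 1)) (hf0 : f 0 = 0) :
    ‖deriv f 0‖ * ‖φ X‖ ≤ caraMetric D z X := by
  have hfd : HasFDerivAt f (ContinuousLinearMap.toSpanSingleton ℂ (deriv f 0)) (φ (z - z)) := by
    rw [sub_self, map_zero]
    exact (hf.differentiableAt (hU.mem_nhds ⟨z, hz, by simp⟩)).hasDerivAt.hasFDerivAt
  have hcomp : HasFDerivAt (fun w => f (φ (w - z)))
      ((ContinuousLinearMap.toSpanSingleton ℂ (deriv f 0)).comp φ) z :=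
    hfd.comp z (φ.hasFDerivAt.comp z ((hasFDerivAt_id z).sub_const z))
  refine le_csSup (bddAbove_caraMetric hD hz X) ⟨fun w => f (φ (w - z)), ?_, ?_, ?_, ?_⟩
  · exact hf.comp (by fun_prop) (mapsTo_image _ D)
  · exact hfm.comp (mapsTo_image _ D)
  · simp [hf0]
  · rw [hcomp.fderiv, ContinuousLinearMap.comp_apply,
      ContinuousLinearMap.toSpanSingleton_apply, norm_smul, mul_comm]

/-- If the complex line through `z` in direction `X` leaves a `ℂ`-convex domain `D` at a point
`z + l • X` of its closure, then the Carathéodory metric is at least `1 / (4 |l|)`. -/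
theorem IsCConvex.inv_le_four_mul_caraMetric {n : ℕ} {D : Set (Cn n)} (hD : IsOpen D)
    (hcc : IsCConvex D) {z X : Cn n} (hz : z ∈ D) {l : ℂ} (hl : z + l • X ∉ D)
    (hl' : z + l • X ∈ closure D) : ‖l‖⁻¹ ≤ 4 * caraMetric D z X := by
  obtain ⟨v, hv⟩ := hcc.exists_inner_ne_zero hD hl hl'
  set b : ℂ := inner ℂ v (l • X) with hb
  have hb0 : b ≠ 0 := by
    have := hv z hz
    rw [sub_add_cancel_left, inner_neg_right] at this
    exact neg_ne_zero.1 this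
  have hl0 : l ≠ 0 := by
    rintro rfl
    simp [hb] at hb0
  set φ : Cn n →L[ℂ] ℂ := b⁻¹ • innerSL ℂ v with hφ
  have hφl : φ (l • X) = 1 := by
    simp only [hφ, smul_apply, innerSL_apply_apply, smul_eq_mul]
    exact inv_mul_cancel₀ hb0
  have hφX : φ X = l⁻¹ := by
    rw [map_smul, smul_eq_mul] at hφl
    exact eq_inv_of_mul_eq_one_right hφl
  have hsurj : Function.Surjective φ := fun y => ⟨y • (l • X), by rw [map_smul, hφl]; simp⟩
  have hopen : IsOpenMap fun w => φ (w - z) :=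
    (φ.isOpenMap hsurj).comp (Homeomorph.subRight z).isOpenMap
  have h1 : (1 : ℂ) ∉ (fun w => φ (w - z)) '' D := by
    rintro ⟨w, hw, h⟩
    refine hv w hw ?_
    have h2 : φ (w - (z + l • X)) = 0 := by
      rw [← sub_sub, map_sub, hφl, sub_eq_zero]
      exact h
    exact (mul_eq_zero.1 h2).resolve_left (inv_ne_zero hb0)
  have key : ∀ t < 1, t / 4 * ‖l‖⁻¹ ≤ caraMetric D z X := fun t ht => by
    obtain ⟨f, hf, hfm, hf0, hft⟩ := exists_mapsTo_ball_norm_deriv_ge (hopen D hD)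
      (fun F hF hF0 => hcc.exists_continuousOn_log_image hD hz hsurj hF hF0)
      ⟨z, hz, by simp⟩ h1 ht
    refine le_trans ?_ (norm_deriv_mul_le_caraMetric hD hz X φ (hopen D hD) hf hfm hf0)
    rw [hφX, norm_inv]
    gcongr
  have hlim : Filter.Tendsto (fun t : ℝ => t / 4 * ‖l‖⁻¹) (𝓝[<] 1) (𝓝 (1 / 4 * ‖l‖⁻¹)) :=
    (Continuous.tendsto (by fun_prop) 1).mono_left nhdsWithin_le_nhds
  have := le_of_tendsto hlim (eventually_mem_nhdsWithin.mono key)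
  linarith

/-- For any ℂ-convex domain `D ⊆ ℂⁿ`, any `z ∈ D` and any `X`,
`κ_D(z;X) ≤ 4·γ_D(z;X)`. -/
theorem statement1 {n : ℕ} (D : Set (Cn n)) (hD : IsDomain' D) (hcc : IsCConvex D)
    (z : Cn n) (hz : z ∈ D) (X : Cn n) :
    kobMetric D z X ≤ 4 * caraMetric D z X := by
  have hDo := hD.1
  set S : Set ℂ := {l | z + l • X ∈ D} with hS
  have hSo : IsOpen S := hDo.preimage (by fun_prop)
  rcases eq_or_ne Sᶜ ∅ with hSu | hne
  · have hSu : ∀ l, l ∈ S := fun l => by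
      by_contra h
      exact (hSu ▸ (h : l ∈ Sᶜ) : l ∈ (∅ : Set ℂ))
    have h0 : kobMetric D z X ≤ 0 := by
      refine ge_of_tendsto tendsto_inv_atTop_zero ?_
      filter_upwards [Filter.eventually_gt_atTop 0] with d hd
      exact kobMetric_le_inv hd fun l _ => hSu l
    exact h0.trans (mul_nonneg (by norm_num) (caraMetric_nonneg D z X))
  · obtain ⟨l, hl, hmin⟩ := hSo.isClosed_compl.exists_infDist_eq_dist
      (nonempty_iff_ne_empty.2 hne) 0
    have hl0 : l ≠ 0 := by
      rintro rfl
      exact hl (by simpa [hS] using hz)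
    have hd : 0 < ‖l‖ := norm_pos_iff.2 hl0
    have hball : ∀ m : ℂ, ‖m‖ < ‖l‖ → z + m • X ∈ D := fun m hm => by
      by_contra h
      have := infDist_le_dist_of_mem (x := (0 : ℂ)) (show m ∈ Sᶜ from h)
      rw [hmin, dist_zero_left, dist_zero_left] at this
      linarith
    refine (kobMetric_le_inv hd hball).trans (hcc.inv_le_four_mul_caraMetric hDo hz hl ?_)
    have h1 : l ∈ closure (ball (0 : ℂ) ‖l‖) := by
      rw [closure_ball _ hd.ne']
      simp
    have h2 : Continuous fun m : ℂ => z + m • X := by fun_prop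
    exact map_mem_closure (f := fun m : ℂ => z + m • X) h2 h1 fun m hm => hball m (by simpa using hm)

end
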